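/- Let A be a finite set of integers with |A| ≥ 5 whose elements attain exactly 2 distinct residues modulo 4, namely 0 and an odd residue u₂ (so A = A₁ ∪ A₂ with A₁ = {a ∈ A : a ≡ 0 (mod 4)} and A₂ = {a ∈ A : a ≡ u₂ (mod 4)}, u₂ odd). Then |A + 4·A| ≥ 5|A| − 6. -/

import Mathlib

open Finset Pointwise

/-- the elements of `X` congruent to `i*u` modulo 4 -/
def cls (X : Finset ℤ) (u i : ℤ) : Finset ℤ := X.filter (fun a => (4 : ℤ) ∣ a - i * u)

/-- dilation by 4 plus translation -/
def dil (Y : Finset ℤ) (u : ℤ) : Finset ℤ := Y.image (fun b => 4 * b + u)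

/-- the sumset of `X` and `4X ∪ (4Y+u)` -/
def SS (X Y : Finset ℤ) (u : ℤ) : Finset ℤ := X + (dil X 0 ∪ dil Y u)

lemma mem_cls {X : Finset ℤ} {u i a : ℤ} : a ∈ cls X u i ↔ a ∈ X ∧ (4 : ℤ) ∣ a - i * u := by
  simp [cls]

lemma mem_dil {Y : Finset ℤ} {u a : ℤ} : a ∈ dil Y u ↔ ∃ b ∈ Y, 4 * b + u = a := by
  simp [dil]

lemma card_dil (Y : Finset ℤ) (u : ℤ) : (dil Y u).card = Y.card := by
  apply card_image_of_injective
  intro a b h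
  simp only at h
  omega

lemma dil_nonempty {Y : Finset ℤ} (h : Y.Nonempty) (u : ℤ) : (dil Y u).Nonempty := h.image _

lemma cls_four (X : Finset ℤ) (u : ℤ) : cls X u 4 = cls X u 0 := by
  ext a; simp only [mem_cls]
  constructor <;> rintro ⟨h, h2⟩ <;> refine ⟨h, ?_⟩ <;> omega

lemma sum_cls (X : Finset ℤ) (u : ℤ) (hu : Odd u) :
    X.card = (cls X u 0).card + (cls X u 1).card + (cls X u 2).card + (cls X u 3).card := by
  have hX : X = ((cls X u 0 ∪ cls X u 1) ∪ cls X u 2) ∪ cls X u 3 := by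
    ext a; simp only [mem_cls, mem_union]
    obtain ⟨k, rfl⟩ := hu
    constructor
    · intro h
      simp only [h, true_and]
      obtain ⟨j, rfl | rfl⟩ : ∃ j, k = 2 * j ∨ k = 2 * j + 1 := ⟨k / 2, by omega⟩ <;>
      obtain ⟨b, rfl | rfl | rfl | rfl⟩ :
        ∃ b, a = 4 * b ∨ a = 4 * b + 1 ∨ a = 4 * b + 2 ∨ a = 4 * b + 3 := ⟨a / 4, by omega⟩ <;>
      omega
    · tauto
  obtain ⟨k, rfl⟩ := hu
  conv_lhs => rw [hX]
  rw [card_union_of_disjoint, card_union_of_disjoint, card_union_of_disjoint]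
  all_goals
    rw [Finset.disjoint_left]
    intro a
    simp only [mem_cls, mem_union]
    omega

lemma sub1 (X Y : Finset ℤ) (u i : ℤ) : cls X u i + dil X 0 ⊆ cls (SS X Y u) u i := by
  intro z hz
  obtain ⟨a, ha, b, hb, rfl⟩ := mem_add.1 hz
  rw [mem_cls] at ha ⊢
  refine ⟨add_mem_add ha.1 (mem_union_left _ hb), ?_⟩
  obtain ⟨c, hc, rfl⟩ := mem_dil.1 hb
  have := ha.2
  omega

lemma sub2 (X Y : Finset ℤ) (u i : ℤ) : cls X u i + dil Y u ⊆ cls (SS X Y u) u (i + 1) := by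
  intro z hz
  obtain ⟨a, ha, b, hb, rfl⟩ := mem_add.1 hz
  rw [mem_cls] at ha ⊢
  refine ⟨add_mem_add ha.1 (mem_union_right _ hb), ?_⟩
  obtain ⟨c, hc, rfl⟩ := mem_dil.1 hb
  have := ha.2
  rw [add_mul]
  omega

lemma cd {s t : Finset ℤ} (hs : s.Nonempty) (ht : t.Nonempty) :
    s.card + t.card - 1 ≤ (s + t).card :=
  cauchy_davenport_add_of_linearOrder_isCancelAdd hs ht

lemma L1 (X Y : Finset ℤ) (u i : ℤ) (h : (cls X u i).card ≠ 0) :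
    (cls X u i).card + X.card - 1 ≤ (cls (SS X Y u) u i).card := by
  have h1 : (cls X u i).Nonempty := card_ne_zero.1 h
  have h2 : X.Nonempty := h1.mono (filter_subset _ _)
  have := cd h1 (dil_nonempty h2 0)
  rw [card_dil] at this
  exact this.trans (card_le_card (sub1 X Y u i))

lemma L2 (X Y : Finset ℤ) (hY : Y.Nonempty) (u i : ℤ) (h : (cls X u i).card ≠ 0) :
    (cls X u i).card + Y.card - 1 ≤ (cls (SS X Y u) u (i + 1)).card := by
  have h1 : (cls X u i).Nonempty := card_ne_zero.1 h
  have := cd h1 (dil_nonempty hY u)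
  rw [card_dil] at this
  exact this.trans (card_le_card (sub2 X Y u i))

lemma three (X : Finset ℤ) : 3 * X.card - 2 ≤ (X + dil X 0).card := by
  induction X using Finset.induction_on_max with
  | empty => simp
  | insert m s hm ih =>
    have hms : m ∉ s := fun h => lt_irrefl _ (hm m h)
    rw [card_insert_of_notMem hms]
    rcases s.eq_empty_or_nonempty with rfl | hs
    · simp [dil]
    · set k := s.max' hs with hk
      have hkm : k ∈ s := s.max'_mem hs
      have hkl : k < m := hm k hkm
      have hd : Disjoint (s + dil s 0) {m + 4 * k, k + 4 * m, m + 4 * m} := by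
        rw [Finset.disjoint_left]
        intro z hz
        obtain ⟨a, ha, b, hb, rfl⟩ := mem_add.1 hz
        obtain ⟨c, hc, rfl⟩ := mem_dil.1 hb
        have h1 := s.le_max' a ha
        have h2 := s.le_max' c hc
        simp only [mem_insert, mem_singleton]
        omega
      have hc3 : ({m + 4 * k, k + 4 * m, m + 4 * m} : Finset ℤ).card = 3 := by
        rw [card_eq_three]
        exact ⟨_, _, _, by omega, by omega, by omega, rfl⟩
      have hsub : (s + dil s 0) ∪ {m + 4 * k, k + 4 * m, m + 4 * m} ⊆
          insert m s + dil (insert m s) 0 := by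
        apply union_subset
        · apply add_subset_add (subset_insert _ _)
          exact image_subset_image (subset_insert _ _)
        · intro z hz
          simp only [mem_insert, mem_singleton] at hz
          have e1 : m ∈ insert m s := mem_insert_self _ _
          have e2 : k ∈ insert m s := mem_insert_of_mem hkm
          have d1 : 4 * m ∈ dil (insert m s) 0 := mem_dil.2 ⟨m, e1, by ring⟩
          have d2 : 4 * k ∈ dil (insert m s) 0 := mem_dil.2 ⟨k, e2, by ring⟩
          rcases hz with rfl | rfl | rfl
          · exact add_mem_add e1 d2
          · exact add_mem_add e2 d1
          · exact add_mem_add e1 d1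
      have := card_le_card hsub
      rw [card_union_of_disjoint hd, hc3] at this
      omega

lemma L3 (X Y : Finset ℤ) (u i : ℤ) (h : (cls X u i).card = X.card) :
    3 * X.card - 2 ≤ (cls (SS X Y u) u i).card := by
  have h1 : cls X u i = X := eq_of_subset_of_card_le (filter_subset _ _) h.ge
  have := card_le_card (sub1 X Y u i)
  rw [h1] at this
  exact (three X).trans this

lemma exists_dil (X : Finset ℤ) (u i : ℤ) : ∃ P, cls X u i = dil P (i * u) := by
  refine ⟨(cls X u i).image (fun a => (a - i * u) / 4), ?_⟩
  ext a
  simp only [mem_dil, mem_image, exists_exists_and_eq_and]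
  constructor
  · intro h
    refine ⟨a, h, ?_⟩
    have := (mem_cls.1 h).2
    omega
  · rintro ⟨b, h, rfl⟩
    have := (mem_cls.1 h).2
    have e : 4 * ((b - i * u) / 4) + i * u = b := by omega
    rwa [e]

lemma dil_comp (P Q : Finset ℤ) (r u : ℤ) :
    dil P r + dil (dil P r ∪ dil Q (r + u)) 0 = dil (SS P Q u) (5 * r) := by
  ext z
  simp only [SS, mem_dil, mem_add, mem_union]
  constructor
  · rintro ⟨_, ⟨a, ha, rfl⟩, _, ⟨_, ⟨b, hb, rfl⟩ | ⟨b, hb, rfl⟩, rfl⟩, rfl⟩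
    · exact ⟨_, ⟨a, ha, _, Or.inl ⟨b, hb, rfl⟩, rfl⟩, by ring⟩
    · exact ⟨_, ⟨a, ha, _, Or.inr ⟨b, hb, rfl⟩, rfl⟩, by ring⟩
  · rintro ⟨_, ⟨a, ha, _, ⟨b, hb, rfl⟩ | ⟨b, hb, rfl⟩, rfl⟩, rfl⟩
    · exact ⟨_, ⟨a, ha, rfl⟩, _, ⟨_, Or.inl ⟨b, hb, rfl⟩, rfl⟩, by ring⟩
    · exact ⟨_, ⟨a, ha, rfl⟩, _, ⟨_, Or.inr ⟨b, hb, rfl⟩, rfl⟩, by ring⟩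

lemma L4 (X Y : Finset ℤ) (u i : ℤ) (hu : Odd u)
    (h : (cls X u i).card + (cls X u (i + 1)).card = X.card) :
    ∃ P Q : Finset ℤ, P.card = (cls X u i).card ∧ Q.card = (cls X u (i + 1)).card ∧
      (SS P Q u).card ≤ (cls (SS X Y u) u i).card ∧
      (SS Q P (-u)).card ≤ (cls (SS X Y u) u (i + 1)).card := by
  have hd : Disjoint (cls X u i) (cls X u (i + 1)) := by
    rw [Finset.disjoint_left]
    intro a
    simp only [mem_cls, add_mul]
    obtain ⟨k, rfl⟩ := hu
    omega
  have hX : cls X u i ∪ cls X u (i + 1) = X := by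
    have hsub : cls X u i ∪ cls X u (i + 1) ⊆ X :=
      union_subset (filter_subset _ _) (filter_subset _ _)
    apply eq_of_subset_of_card_le hsub
    rw [card_union_of_disjoint hd, h]
  have s1 := card_le_card (sub1 X Y u i)
  have s2 := card_le_card (sub1 X Y u (i + 1))
  obtain ⟨P, hP⟩ := exists_dil X u i
  obtain ⟨Q, hQ⟩ := exists_dil X u (i + 1)
  refine ⟨P, Q, by rw [hP, card_dil], by rw [hQ, card_dil], ?_, ?_⟩
  · refine le_trans (le_of_eq ?_) s1
    have e : (i + 1) * u = i * u + u := by ring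
    have e2 : X = dil P (i * u) ∪ dil Q (i * u + u) := by rw [← hP, ← e, ← hQ, hX]
    have e3 := dil_comp P Q (i * u) u
    rw [← e2] at e3
    rw [hP, e3, card_dil]
  · refine le_trans (le_of_eq ?_) s2
    have e : i * u = (i + 1) * u + -u := by ring
    have e2 : X = dil Q ((i + 1) * u) ∪ dil P ((i + 1) * u + -u) := by
      rw [← hQ, ← e, ← hP, union_comm, hX]
    have e3 := dil_comp Q P ((i + 1) * u) (-u)
    rw [← e2] at e3
    rw [hQ, e3, card_dil]

lemma min_eq {P Q S T : Finset ℤ} {u v mP mQ mS mT : ℤ} (h : P + dil S u = Q + dil T v)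
    (hP : IsLeast (P : Set ℤ) mP) (hQ : IsLeast (Q : Set ℤ) mQ)
    (hS : IsLeast (S : Set ℤ) mS) (hT : IsLeast (T : Set ℤ) mT) :
    mP + (4 * mS + u) = mQ + (4 * mT + v) := by
  have aux : ∀ {P Q S T : Finset ℤ} {u v mP mQ mS mT : ℤ} (_ : P + dil S u = Q + dil T v)
      (_ : IsLeast (P : Set ℤ) mP) (_ : IsLeast (Q : Set ℤ) mQ)
      (_ : IsLeast (S : Set ℤ) mS) (_ : IsLeast (T : Set ℤ) mT),
      mQ + (4 * mT + v) ≤ mP + (4 * mS + u) := by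
    intro P Q S T u v mP mQ mS mT h hP hQ hS hT
    have : mP + (4 * mS + u) ∈ Q + dil T v := by
      rw [← h]
      exact add_mem_add (mem_coe.1 hP.1) (mem_dil.2 ⟨mS, mem_coe.1 hS.1, rfl⟩)
    obtain ⟨a, ha, b, hb, e⟩ := mem_add.1 this
    obtain ⟨c, hc, rfl⟩ := mem_dil.1 hb
    have h1 := hQ.2 (mem_coe.2 ha)
    have h2 := hT.2 (mem_coe.2 hc)
    omega
  exact le_antisymm (aux h.symm hQ hP hT hS) (aux h hP hQ hS hT)

lemma L5 (X Y : Finset ℤ) (u : ℤ) (hu : Odd u) (hxy : X.card = Y.card)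
    (h0 : (cls X u 0).card ≠ 0) (h1 : (cls X u 1).card ≠ 0) (h2 : (cls X u 2).card ≠ 0)
    (h3 : (cls X u 3).card ≠ 0) : 5 * X.card - 3 ≤ (SS X Y u).card := by
  by_contra hcon
  have hX : X.Nonempty := (card_ne_zero.1 h0).mono (filter_subset _ _)
  have hXp := hX.card_pos
  have hY : Y.Nonempty := card_pos.1 (by omega)
  have sX := sum_cls X u hu
  have sZ := sum_cls (SS X Y u) u hu
  have key : ∀ i, (cls X u i).card ≠ 0 →
      (cls X u i).card + X.card - 1 ≤ (cls X u i + dil X 0).card ∧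
      (cls X u i).card + X.card - 1 ≤ (cls X u i + dil Y u).card := by
    intro i hi
    have a1 := cd (card_ne_zero.1 hi) (dil_nonempty hX 0)
    have a2 := cd (card_ne_zero.1 hi) (dil_nonempty hY u)
    rw [card_dil] at a1 a2
    omega
  have k0 := key 0 h0
  have k1 := key 1 h1
  have k2 := key 2 h2
  have k3 := key 3 h3
  have p0 := card_le_card (sub1 X Y u 0)
  have p1 := card_le_card (sub1 X Y u 1)
  have p2 := card_le_card (sub1 X Y u 2)
  have p3 := card_le_card (sub1 X Y u 3)
  have q0 := card_le_card (sub2 X Y u 0)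
  have q1 := card_le_card (sub2 X Y u 1)
  have q2 := card_le_card (sub2 X Y u 2)
  have q3 := card_le_card (sub2 X Y u 3)
  have t3 := sub2 X Y u 3
  norm_num [cls_four] at q0 q1 q2 q3 t3
  have e0 := eq_of_subset_of_card_le (sub1 X Y u 0) (by omega)
  have e1 := eq_of_subset_of_card_le (sub1 X Y u 1) (by omega)
  have e2 := eq_of_subset_of_card_le (sub1 X Y u 2) (by omega)
  have e3 := eq_of_subset_of_card_le (sub1 X Y u 3) (by omega)
  have f0 := eq_of_subset_of_card_le (sub2 X Y u 0) (by norm_num; omega)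
  have f1 := eq_of_subset_of_card_le (sub2 X Y u 1) (by norm_num; omega)
  have f2 := eq_of_subset_of_card_le (sub2 X Y u 2) (by norm_num; omega)
  have f3 := eq_of_subset_of_card_le t3 (by omega)
  norm_num at f0 f1 f2
  have mx := X.isLeast_min' hX
  have my := Y.isLeast_min' hY
  have m0 := (cls X u 0).isLeast_min' (card_ne_zero.1 h0)
  have m1 := (cls X u 1).isLeast_min' (card_ne_zero.1 h1)
  have m2 := (cls X u 2).isLeast_min' (card_ne_zero.1 h2)
  have m3 := (cls X u 3).isLeast_min' (card_ne_zero.1 h3)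
  have g0 := min_eq (f0.trans e1.symm) m0 m1 my mx
  have g1 := min_eq (f1.trans e2.symm) m1 m2 my mx
  have g2 := min_eq (f2.trans e3.symm) m2 m3 my mx
  have g3 := min_eq (f3.trans e0.symm) m3 m0 my mx
  have c0 := (mem_cls.1 (mem_coe.1 m0.1)).2
  have c1 := (mem_cls.1 (mem_coe.1 m1.1)).2
  obtain ⟨k, rfl⟩ := hu
  omega

lemma L6 (X Y : Finset ℤ) (u i : ℤ) (hu : Odd u) (hX : X.card = 3) (hY : Y.card = 2)
    (hP : (cls X u i).card = 2) (hQ : (cls X u (i + 1)).card = 1) :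
    4 ≤ (cls (SS X Y u) u (i + 1)).card := by
  by_contra hcon
  have w1 : ∃ a b, a < b ∧ a ∈ cls X u i ∧ b ∈ cls X u i := by
    obtain ⟨a, b, hab, e⟩ := card_eq_two.1 hP
    rcases lt_or_gt_of_ne hab with h | h
    · exact ⟨a, b, h, by simp [e], by simp [e]⟩
    · exact ⟨b, a, h, by simp [e], by simp [e]⟩
  have w2 : ∃ a b, a < b ∧ a ∈ Y ∧ b ∈ Y := by
    obtain ⟨a, b, hab, e⟩ := card_eq_two.1 hY
    rcases lt_or_gt_of_ne hab with h | h
    · exact ⟨a, b, h, by simp [e], by simp [e]⟩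
    · exact ⟨b, a, h, by simp [e], by simp [e]⟩
  obtain ⟨a, b, hab, ha, hb⟩ := w1
  obtain ⟨v, w, hvw, hv, hw⟩ := w2
  obtain ⟨z, hz⟩ := card_eq_one.1 hQ
  have hzm : z ∈ cls X u (i + 1) := by simp [hz]
  have hza := (mem_cls.1 hzm).2
  have haa := (mem_cls.1 ha).2
  have hbb := (mem_cls.1 hb).2
  have hneq : z ≠ a ∧ z ≠ b := by
    rw [add_mul] at hza
    obtain ⟨k, rfl⟩ := hu
    omega
  have hXe : {a, b, z} = X := by
    apply eq_of_subset_of_card_le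
    · intro t ht
      simp only [mem_insert, mem_singleton] at ht
      rcases ht with rfl | rfl | rfl
      · exact (mem_cls.1 ha).1
      · exact (mem_cls.1 hb).1
      · exact (mem_cls.1 hzm).1
    · rw [hX, card_eq_three.2 ⟨a, b, z, by omega, by omega, by omega, rfl⟩]
  have hs := sub1 X Y u (i + 1)
  have he : cls X u (i + 1) + dil X 0 = cls (SS X Y u) u (i + 1) := by
    apply eq_of_subset_of_card_le hs
    rw [hz, card_singleton_add, card_dil]
    omega
  have ht := sub2 X Y u i
  rw [← he] at ht
  have mm : ∀ p ∈ cls X u i, ∀ y ∈ Y, p + (4 * y + u) = z + 4 * a ∨ p + (4 * y + u) = z + 4 * b ∨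
      p + (4 * y + u) = z + 4 * z := by
    intro p hp y hy
    have := ht (add_mem_add hp (mem_dil.2 ⟨y, hy, rfl⟩))
    rw [hz, ← hXe] at this
    simp only [mem_add, mem_singleton, mem_dil, mem_insert] at this
    obtain ⟨_, rfl, _, ⟨t, ht, rfl⟩, e⟩ := this
    rcases ht with rfl | rfl | rfl <;> omega
  have m1 := mm a ha v hv
  have m2 := mm b hb v hv
  have m3 := mm a ha w hw
  have m4 := mm b hb w hw
  clear mm ht he hs hza haa hbb
  omega

/-- basic numeric data -/
lemma data (X Y : Finset ℤ) (hY : Y.Nonempty) (u : ℤ) (hu : Odd u)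
    (c : ℕ → ℕ → ℕ)
    (hc : ∀ P Q : Finset ℤ, ∀ v : ℤ, Odd v → P.Nonempty → Q.Nonempty →
      c P.card Q.card ≤ (SS P Q v).card) :
    ∃ n0 n1 n2 n3 z0 z1 z2 z3 : ℕ, X.card = n0 + n1 + n2 + n3 ∧
      (SS X Y u).card = z0 + z1 + z2 + z3 ∧
      (n0 ≠ 0 → n0 + X.card - 1 ≤ z0 ∧ n0 + Y.card - 1 ≤ z1) ∧
      (n1 ≠ 0 → n1 + X.card - 1 ≤ z1 ∧ n1 + Y.card - 1 ≤ z2) ∧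
      (n2 ≠ 0 → n2 + X.card - 1 ≤ z2 ∧ n2 + Y.card - 1 ≤ z3) ∧
      (n3 ≠ 0 → n3 + X.card - 1 ≤ z3 ∧ n3 + Y.card - 1 ≤ z0) ∧
      (n0 = X.card → 3 * X.card - 2 ≤ z0) ∧
      (n1 = X.card → 3 * X.card - 2 ≤ z1) ∧
      (n2 = X.card → 3 * X.card - 2 ≤ z2) ∧
      (n3 = X.card → 3 * X.card - 2 ≤ z3) ∧
      (n0 + n1 = X.card → n0 ≠ 0 → n1 ≠ 0 → c n0 n1 ≤ z0 ∧ c n1 n0 ≤ z1 ∧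
        (Y.card = 2 → n0 = 2 → n1 = 1 → 4 ≤ z1)) ∧
      (n1 + n2 = X.card → n1 ≠ 0 → n2 ≠ 0 → c n1 n2 ≤ z1 ∧ c n2 n1 ≤ z2 ∧
        (Y.card = 2 → n1 = 2 → n2 = 1 → 4 ≤ z2)) ∧
      (n2 + n3 = X.card → n2 ≠ 0 → n3 ≠ 0 → c n2 n3 ≤ z2 ∧ c n3 n2 ≤ z3 ∧
        (Y.card = 2 → n2 = 2 → n3 = 1 → 4 ≤ z3)) ∧
      (n3 + n0 = X.card → n3 ≠ 0 → n0 ≠ 0 → c n3 n0 ≤ z3 ∧ c n0 n3 ≤ z0 ∧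
        (Y.card = 2 → n3 = 2 → n0 = 1 → 4 ≤ z0)) ∧
      (X.card = Y.card → n0 ≠ 0 → n1 ≠ 0 → n2 ≠ 0 → n3 ≠ 0 →
        5 * X.card - 3 ≤ z0 + z1 + z2 + z3) := by
  have A1 : ∀ i, (cls X u i).card ≠ 0 →
      (cls X u i).card + X.card - 1 ≤ (cls (SS X Y u) u i).card ∧
      (cls X u i).card + Y.card - 1 ≤ (cls (SS X Y u) u (i + 1)).card :=
    fun i h => ⟨L1 X Y u i h, L2 X Y hY u i h⟩
  have A4 : ∀ i, (cls X u i).card + (cls X u (i + 1)).card = X.card → (cls X u i).card ≠ 0 →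
      (cls X u (i + 1)).card ≠ 0 →
      c (cls X u i).card (cls X u (i + 1)).card ≤ (cls (SS X Y u) u i).card ∧
      c (cls X u (i + 1)).card (cls X u i).card ≤ (cls (SS X Y u) u (i + 1)).card ∧
      (Y.card = 2 → (cls X u i).card = 2 → (cls X u (i + 1)).card = 1 →
        4 ≤ (cls (SS X Y u) u (i + 1)).card) := by
    intro i h hi hj
    obtain ⟨P, Q, hP, hQ, e1, e2⟩ := L4 X Y u i hu h
    have nP : P.Nonempty := card_ne_zero.1 (hP ▸ hi)
    have nQ : Q.Nonempty := card_ne_zero.1 (hQ ▸ hj)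
    refine ⟨?_, ?_, ?_⟩
    · rw [← hP, ← hQ]; exact (hc P Q u hu nP nQ).trans e1
    · rw [← hP, ← hQ]; exact (hc Q P (-u) hu.neg nQ nP).trans e2
    · intro hY2 h2 h1
      exact L6 X Y u i hu (by omega) hY2 h2 h1
  have hs := sum_cls (SS X Y u) u hu
  have a0 := A1 0
  have a1 := A1 1
  have a2 := A1 2
  have a3 := A1 3
  have b0 := A4 0
  have b1 := A4 1
  have b2 := A4 2
  have b3 := A4 3
  rw [show (0 : ℤ) + 1 = 1 by norm_num] at a0 b0
  rw [show (1 : ℤ) + 1 = 2 by norm_num] at a1 b1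
  rw [show (2 : ℤ) + 1 = 3 by norm_num] at a2 b2
  rw [show (3 : ℤ) + 1 = 4 by norm_num] at a3 b3
  rw [cls_four] at a3
  rw [cls_four, cls_four] at b3
  refine ⟨_, _, _, _, _, _, _, _, sum_cls X u hu, hs, a0, a1, a2, a3,
    L3 X Y u 0, L3 X Y u 1, L3 X Y u 2, L3 X Y u 3, b0, b1, b2, b3, ?_⟩
  rw [← hs]
  exact L5 X Y u hu

lemma F1 (X Y : Finset ℤ) (u : ℤ) (hu : Odd u) (hX : X.Nonempty) (hY : Y.Nonempty) :
    3 * X.card + Y.card - 2 ≤ (SS X Y u).card := by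
  obtain ⟨n0, n1, n2, n3, z0, z1, z2, z3, h⟩ := data X Y hY u hu (fun _ _ => 0) (by simp)
  have := hX.card_pos
  have := hY.card_pos
  generalize X.card = x at *
  generalize Y.card = y at *
  generalize (SS X Y u).card = f at *
  obtain ⟨rfl, rfl, h⟩ := h
  by_cases h0 : n0 = 0 <;> by_cases h1 : n1 = 0 <;> by_cases h2 : n2 = 0 <;>
  by_cases h3 : n3 = 0 <;> simp [h0, h1, h2, h3] at h ⊢ <;> omega

lemma F2 (X Y : Finset ℤ) (u : ℤ) (hu : Odd u) (hX : X.Nonempty) (hY : Y.Nonempty) :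
    4 * X.card + Y.card - 4 ≤ (SS X Y u).card := by
  obtain ⟨n0, n1, n2, n3, z0, z1, z2, z3, h⟩ := data X Y hY u hu (fun x y => 3 * x + y - 2) F1
  have := hX.card_pos
  have := hY.card_pos
  generalize X.card = x at *
  generalize Y.card = y at *
  generalize (SS X Y u).card = f at *
  obtain ⟨rfl, rfl, h⟩ := h
  by_cases h0 : n0 = 0 <;> by_cases h1 : n1 = 0 <;> by_cases h2 : n2 = 0 <;>
  by_cases h3 : n3 = 0 <;> simp [h0, h1, h2, h3] at h ⊢ <;> omega

set_option maxHeartbeats 2000000 in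
lemma F3 (X Y : Finset ℤ) (u : ℤ) (hu : Odd u) (hX : X.Nonempty) (hY : Y.Nonempty)
    (hxy : 5 ≤ X.card + Y.card) :
    4 * X.card + Y.card - 3 ≤ (SS X Y u).card := by
  obtain ⟨n0, n1, n2, n3, z0, z1, z2, z3, h⟩ := data X Y hY u hu
    (fun x y => max (3 * x + y - 2) (4 * x + y - 4))
    (fun P Q v hv hP hQ => max_le (F1 P Q v hv hP hQ) (F2 P Q v hv hP hQ))
  have := hX.card_pos
  have := hY.card_pos
  simp only [max_le_iff] at h
  generalize X.card = x at *
  generalize Y.card = y at *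
  generalize (SS X Y u).card = f at *
  obtain ⟨rfl, rfl, h⟩ := h
  by_cases h0 : n0 = 0 <;> by_cases h1 : n1 = 0 <;> by_cases h2 : n2 = 0 <;>
  by_cases h3 : n3 = 0 <;> simp [h0, h1, h2, h3] at h ⊢ <;> omega

/-- Let `A` be a finite set of integers with `|A| ≥ 5` attaining exactly 2 distinct residues
modulo 4, namely `0` and an odd residue `u₂`. Then `|A + 4·A| ≥ 5|A| − 6`. -/
theorem stmt_19 (A : Finset ℤ) (hA : 5 ≤ A.card)
    (u₂ : ℤ) (hodd : Odd u₂)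
    (himg : A.image (fun a => a % 4) = {0, u₂}) :
    (5 : ℤ) * A.card - 6 ≤ ((A + A.image (fun b => (4 : ℤ) * b)).card : ℤ) := by
  obtain ⟨X, hX⟩ := exists_dil A u₂ 0
  obtain ⟨Y, hY⟩ := exists_dil A u₂ 1
  have hd : Disjoint (cls A u₂ 0) (cls A u₂ 1) := by
    rw [Finset.disjoint_left]
    intro a
    simp only [mem_cls]
    obtain ⟨k, rfl⟩ := hodd
    omega
  have hres : ∀ a ∈ A, a % 4 = 0 ∨ a % 4 = u₂ := by
    intro a ha
    have : a % 4 ∈ A.image (fun a => a % 4) := mem_image_of_mem _ ha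
    rw [himg] at this
    simpa using this
  have hAe : A = cls A u₂ 0 ∪ cls A u₂ 1 := by
    ext a
    simp only [mem_union, mem_cls]
    constructor
    · intro ha
      have := hres a ha
      simp only [ha, true_and]
      omega
    · tauto
  have h0 : (cls A u₂ 0).Nonempty := by
    have : (0 : ℤ) ∈ A.image (fun a => a % 4) := by rw [himg]; simp
    obtain ⟨a, ha, e⟩ := mem_image.1 this
    exact ⟨a, mem_cls.2 ⟨ha, by omega⟩⟩
  have h1 : (cls A u₂ 1).Nonempty := by
    have : u₂ ∈ A.image (fun a => a % 4) := by rw [himg]; simp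
    obtain ⟨a, ha, e⟩ := mem_image.1 this
    exact ⟨a, mem_cls.2 ⟨ha, by omega⟩⟩
  have hcard : A.card = X.card + Y.card := by
    conv_lhs => rw [hAe, card_union_of_disjoint hd, hX, hY, card_dil, card_dil]
  have nX : X.Nonempty := by
    have := h0.card_pos
    rw [hX, card_dil] at this
    exact card_pos.1 this
  have nY : Y.Nonempty := by
    have := h1.card_pos
    rw [hY, card_dil] at this
    exact card_pos.1 this
  have e4 : A.image (fun b => (4 : ℤ) * b) = dil A 0 := by simp [dil]
  have c1 : dil X (0 * u₂) + dil A 0 = dil (SS X Y u₂) (5 * (0 * u₂)) := by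
    rw [← dil_comp, hAe, hX, hY]
    congr 5
    ring
  have c2 : dil Y (1 * u₂) + dil A 0 = dil (SS Y X (-u₂)) (5 * (1 * u₂)) := by
    rw [← dil_comp, hAe, hX, hY, union_comm]
    congr 5
    ring
  have hsum : A + dil A 0 = dil (SS X Y u₂) (5 * (0 * u₂)) ∪ dil (SS Y X (-u₂)) (5 * (1 * u₂)) := by
    rw [← c1, ← c2, ← union_add, ← hX, ← hY, ← hAe]
  have hdd : Disjoint (dil (SS X Y u₂) (5 * (0 * u₂))) (dil (SS Y X (-u₂)) (5 * (1 * u₂))) := by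
    rw [Finset.disjoint_left]
    intro a
    simp only [mem_dil]
    rintro ⟨b, -, rfl⟩ ⟨c, -, e⟩
    obtain ⟨k, rfl⟩ := hodd
    omega
  have f1 := F3 X Y u₂ hodd nX nY (by omega)
  have f2 := F3 Y X (-u₂) hodd.neg nY nX (by omega)
  rw [e4, hsum, card_union_of_disjoint hdd, card_dil, card_dil]
  omega
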